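/- arXiv:2312.02036 — 9 statements merged into one kernel-verified Lean document; each statement's English description precedes it below -/
import Mathlib

section
/- Let S be a regular ordered semigroup and let a, b ∈ S. Then (Sa] = (Sb] if and only if there exist x, y ∈ S such that a ≤ x·b and b ≤ y·a. -/
variable {S : Type*}

/-- Downward closure `(A] = {x | ∃ a ∈ A, x ≤ a}`. -/
def dcl [LE S] (A : Set S) : Set S := {x | ∃ a ∈ A, x ≤ a}

/-- Product of subsets `UV = {u·v | u ∈ U, v ∈ V}`. -/
def setMul [Mul S] (A B : Set S) : Set S := {x | ∃ a ∈ A, ∃ b ∈ B, x = a * b}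

/-- Compatibility of the order with multiplication (ordered semigroup axiom). -/
def OrdCompat (S : Type*) [Mul S] [LE S] : Prop :=
  ∀ x a b : S, a ≤ b → x * a ≤ x * b ∧ a * x ≤ b * x

/-- A bi-ideal: nonempty, `A·S·A ⊆ A`, and `(A] = A`. -/
def IsBiIdeal [Semigroup S] [LE S] (A : Set S) : Prop :=
  A.Nonempty ∧ (∀ a ∈ A, ∀ s : S, ∀ b ∈ A, a * s * b ∈ A) ∧ dcl A = A

/-- A right ideal: nonempty, `R·S ⊆ R`, `(R] = R`. -/
def IsRightIdeal [Semigroup S] [LE S] (R : Set S) : Prop :=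
  R.Nonempty ∧ (∀ r ∈ R, ∀ s : S, r * s ∈ R) ∧ dcl R = R

/-- A left ideal: nonempty, `S·L ⊆ L`, `(L] = L`. -/
def IsLeftIdeal [Semigroup S] [LE S] (L : Set S) : Prop :=
  L.Nonempty ∧ (∀ l ∈ L, ∀ s : S, s * l ∈ L) ∧ dcl L = L

/-- Principal left ideal `L(a) = ({a} ∪ Sa]`. -/
def Lp [Semigroup S] [LE S] (a : S) : Set S :=
  dcl (({a} : Set S) ∪ Set.range (fun s => s * a))

/-- Principal right ideal `R(a) = ({a} ∪ aS]`. -/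
def Rp [Semigroup S] [LE S] (a : S) : Set S :=
  dcl (({a} : Set S) ∪ Set.range (fun s => a * s))

theorem mem_dcl_range_mul [Semigroup S] [LE S] {a x : S} :
    x ∈ dcl (Set.range (fun s : S => s * a)) ↔ ∃ s : S, x ≤ s * a := by
  simp [dcl]

theorem dcl_range_mul_subset [Semigroup S] [PartialOrder S] (hcomp : OrdCompat S) {a b x : S}
    (h : a ≤ x * b) :
    dcl (Set.range (fun s : S => s * a)) ⊆ dcl (Set.range (fun s : S => s * b)) := by
  intro z hz
  obtain ⟨s, hs⟩ := mem_dcl_range_mul.1 hz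
  refine mem_dcl_range_mul.2 ⟨s * x, hs.trans ?_⟩
  rw [mul_assoc]
  exact (hcomp s a (x * b) h).1

theorem self_mem_dcl_range_mul [Semigroup S] [LE S]
    (hreg : ∀ a : S, ∃ x : S, a ≤ a * x * a) (a : S) :
    a ∈ dcl (Set.range (fun s : S => s * a)) :=
  let ⟨x, hx⟩ := hreg a
  mem_dcl_range_mul.2 ⟨a * x, hx⟩

theorem stmt_0 [Semigroup S] [PartialOrder S] (hcomp : OrdCompat S)
    (hreg : ∀ a : S, ∃ x : S, a ≤ a * x * a) (a b : S) :
    dcl (Set.range (fun s : S => s * a)) = dcl (Set.range (fun s : S => s * b)) ↔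
      ∃ x y : S, a ≤ x * b ∧ b ≤ y * a := by
  constructor
  · intro h
    obtain ⟨x, hx⟩ := mem_dcl_range_mul.1 (h ▸ self_mem_dcl_range_mul hreg a)
    obtain ⟨y, hy⟩ := mem_dcl_range_mul.1 (h.symm ▸ self_mem_dcl_range_mul hreg b)
    exact ⟨x, y, hx, hy⟩
  · rintro ⟨x, y, hx, hy⟩
    exact (dcl_range_mul_subset hcomp hx).antisymm (dcl_range_mul_subset hcomp hy)
end

section
/- Let S be a regular ordered semigroup and let a, b ∈ S. Then (aS] = (bS] if and only if there exist u, v ∈ S such that a ≤ b·u and b ≤ a·v. -/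
variable {S : Type*}

theorem mem_dcl_range_mul_of_regular [Semigroup S] [LE S]
    (hreg : ∀ a : S, ∃ x : S, a ≤ a * x * a) (a : S) :
    a ∈ dcl (Set.range (fun s : S => a * s)) := by
  obtain ⟨x, hx⟩ := hreg a
  exact ⟨a * (x * a), ⟨x * a, rfl⟩, by rwa [← mul_assoc]⟩

theorem dcl_range_mul_subset_of_le [Semigroup S] [Preorder S] (hcomp : OrdCompat S)
    {a b u : S} (h : a ≤ b * u) :
    dcl (Set.range (fun s : S => a * s)) ⊆ dcl (Set.range (fun s : S => b * s)) := by
  rintro x ⟨_, ⟨s, rfl⟩, hx⟩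
  exact ⟨b * (u * s), ⟨u * s, rfl⟩,
    hx.trans (by simpa only [mul_assoc] using (hcomp s a (b * u) h).2)⟩

theorem stmt_1 [Semigroup S] [PartialOrder S] (hcomp : OrdCompat S)
    (hreg : ∀ a : S, ∃ x : S, a ≤ a * x * a) (a b : S) :
    dcl (Set.range (fun s : S => a * s)) = dcl (Set.range (fun s : S => b * s)) ↔
      ∃ u v : S, a ≤ b * u ∧ b ≤ a * v := by
  constructor
  · intro h
    have ha := mem_dcl_range_mul_of_regular hreg a
    have hb := mem_dcl_range_mul_of_regular hreg b
    rw [h] at ha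
    rw [← h] at hb
    obtain ⟨_, ⟨u, rfl⟩, hu⟩ := ha
    obtain ⟨_, ⟨v, rfl⟩, hv⟩ := hb
    exact ⟨u, v, hu, hv⟩
  · rintro ⟨u, v, hu, hv⟩
    exact (dcl_range_mul_subset_of_le hcomp hu).antisymm (dcl_range_mul_subset_of_le hcomp hv)
end

section
/- Let S be a regular ordered semigroup and let A, B be bi-ideals of S. If there exist bi-ideals X and Y of S such that A = (BX] and B = (AY], then for every a ∈ A there exists b ∈ B with (aS] = (bS], and for every b ∈ B there exists a ∈ A with (aS] = (bS]. -/
variable {S : Type*}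

theorem exists_mem_dcl_range_mul_eq [Semigroup S] [Preorder S] (hcomp : OrdCompat S)
    (hreg : ∀ a : S, ∃ x : S, a ≤ a * x * a) {A B X Y : Set S}
    (hA : ∀ a ∈ A, ∀ s : S, ∀ b ∈ A, a * s * b ∈ A)
    (hAX : A ⊆ dcl (setMul B X)) (hBY : B = dcl (setMul A Y)) {a : S} (ha : a ∈ A) :
    ∃ b ∈ B,
      dcl (Set.range (fun s : S => a * s)) = dcl (Set.range (fun s : S => b * s)) := by
  obtain ⟨_, ⟨b, hb, x, -, rfl⟩, hab⟩ := hAX ha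
  obtain ⟨z, hz⟩ := hreg a
  have hb' := hb
  rw [hBY] at hb'
  obtain ⟨_, ⟨c, hc, y, hy, rfl⟩, hbc⟩ := hb'
  have hle : a ≤ a * z * b * x := by
    rw [mul_assoc (a * z)]
    exact hz.trans (hcomp (a * z) _ _ hab).1
  refine ⟨a * z * b, ?_, ?_⟩
  · rw [hBY]
    refine ⟨a * z * c * y, ⟨_, hA a ha z c hc, y, hy, rfl⟩, ?_⟩
    rw [mul_assoc (a * z) c y]
    exact (hcomp (a * z) _ _ hbc).1
  · ext w
    constructor
    · rintro ⟨_, ⟨s, rfl⟩, hw⟩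
      refine ⟨_, ⟨x * s, rfl⟩, hw.trans ?_⟩
      simpa only [mul_assoc] using (hcomp s _ _ hle).2
    · rintro ⟨_, ⟨s, rfl⟩, hw⟩
      exact ⟨_, ⟨z * b * s, rfl⟩, by simpa only [mul_assoc] using hw⟩

theorem stmt_5 [Semigroup S] [PartialOrder S] (hcomp : OrdCompat S)
    (hreg : ∀ a : S, ∃ x : S, a ≤ a * x * a)
    (A B : Set S) (hA : IsBiIdeal A) (hB : IsBiIdeal B)
    (h : ∃ X Y : Set S, IsBiIdeal X ∧ IsBiIdeal Y ∧
      A = dcl (setMul B X) ∧ B = dcl (setMul A Y)) :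
    (∀ a ∈ A, ∃ b ∈ B,
      dcl (Set.range (fun s : S => a * s)) = dcl (Set.range (fun s : S => b * s))) ∧
    (∀ b ∈ B, ∃ a ∈ A,
      dcl (Set.range (fun s : S => a * s)) = dcl (Set.range (fun s : S => b * s))) := by
  obtain ⟨X, Y, -, -, hAX, hBY⟩ := h
  refine ⟨fun a ha => exists_mem_dcl_range_mul_eq hcomp hreg hA.2.1 hAX.subset hBY ha,
    fun b hb => ?_⟩
  obtain ⟨a, ha, hab⟩ := exists_mem_dcl_range_mul_eq hcomp hreg hB.2.1 hBY.subset hAX hb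
  exact ⟨a, ha, hab.symm⟩
end

section
/- Let S be an ordered semigroup. Then S is regular if and only if for every bi-ideal A of S there exists a bi-ideal X of S such that ((AX]A] = A (i.e. every element of the semigroup of bi-ideals 𝓑(S), with product A∗B = (AB], is regular). -/
variable {S : Type*}

theorem OrdCompat.mul_le_mul [Mul S] [Preorder S] (hcomp : OrdCompat S) {a b c d : S}
    (hab : a ≤ b) (hcd : c ≤ d) : a * c ≤ b * d :=
  ((hcomp c a b hab).2).trans (hcomp b c d hcd).1

theorem subset_dcl [Preorder S] (A : Set S) : A ⊆ dcl A := fun x hx => ⟨x, hx, le_rfl⟩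

theorem dcl_dcl [Preorder S] (A : Set S) : dcl (dcl A) = dcl A := by
  refine Set.Subset.antisymm ?_ (subset_dcl _)
  rintro x ⟨y, ⟨z, hz, hyz⟩, hxy⟩
  exact ⟨z, hz, hxy.trans hyz⟩

theorem IsBiIdeal.mem_of_le [Semigroup S] [LE S] {A : Set S} (hA : IsBiIdeal A) {x a : S}
    (ha : a ∈ A) (hxa : x ≤ a) : x ∈ A := by
  rw [← hA.2.2]
  exact ⟨a, ha, hxa⟩

theorem isBiIdeal_univ [Semigroup S] [Preorder S] [Nonempty S] :
    IsBiIdeal (Set.univ : Set S) :=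
  ⟨Set.univ_nonempty, fun _ _ _ _ _ => Set.mem_univ _, Set.univ_subset_iff.1 (subset_dcl _)⟩

/-- The bi-ideal `({a} ∪ aSa]` generated by `a`. -/
def principalBiIdeal [Semigroup S] [LE S] (a : S) : Set S :=
  dcl (({a} : Set S) ∪ Set.range (fun s => a * s * a))

theorem mem_principalBiIdeal_self [Semigroup S] [Preorder S] (a : S) :
    a ∈ principalBiIdeal a :=
  subset_dcl _ (Or.inl rfl)

theorem exists_mul_mul_le_of_mem_principalBiIdeal [Semigroup S] [Preorder S]
    (hcomp : OrdCompat S) {a c d : S} (hc : c ∈ principalBiIdeal a)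
    (hd : d ∈ principalBiIdeal a) (s : S) : ∃ t, c * s * d ≤ a * t * a := by
  obtain ⟨c', hc', hcc'⟩ := hc
  obtain ⟨d', hd', hdd'⟩ := hd
  have hle : c * s * d ≤ c' * s * d' :=
    hcomp.mul_le_mul (hcomp.mul_le_mul hcc' le_rfl) hdd'
  suffices ∃ t, c' * s * d' = a * t * a from
    this.imp fun t ht => hle.trans_eq ht
  obtain rfl | ⟨u, rfl⟩ := hc' <;> obtain rfl | ⟨v, rfl⟩ := hd'
  · exact ⟨s, rfl⟩
  · exact ⟨s * c' * v, by simp only [mul_assoc]⟩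
  · exact ⟨u * d' * s, by simp only [mul_assoc]⟩
  · exact ⟨u * a * s * a * v, by simp only [mul_assoc]⟩

theorem isBiIdeal_principalBiIdeal [Semigroup S] [Preorder S] (hcomp : OrdCompat S) (a : S) :
    IsBiIdeal (principalBiIdeal a) := by
  refine ⟨⟨a, mem_principalBiIdeal_self a⟩, fun c hc s d hd => ?_, dcl_dcl _⟩
  obtain ⟨t, ht⟩ := exists_mul_mul_le_of_mem_principalBiIdeal hcomp hc hd s
  exact ⟨a * t * a, Or.inr ⟨t, rfl⟩, ht⟩

theorem stmt_7 [Semigroup S] [PartialOrder S] (hcomp : OrdCompat S) :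
    (∀ a : S, ∃ x : S, a ≤ a * x * a) ↔
      ∀ A : Set S, IsBiIdeal A → ∃ X : Set S, IsBiIdeal X ∧
        dcl (setMul (dcl (setMul A X)) A) = A := by
  constructor
  · intro hreg A hA
    have : Nonempty S := hA.1.to_type
    refine ⟨Set.univ, isBiIdeal_univ, Set.Subset.antisymm ?_ fun a ha => ?_⟩
    · rintro x ⟨_, ⟨p, ⟨_, ⟨c, hc, s, -, rfl⟩, hp⟩, d, hd, rfl⟩, hx⟩
      exact hA.mem_of_le (hA.2.1 c hc s d hd) (hx.trans (hcomp.mul_le_mul hp le_rfl))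
    · obtain ⟨x, hx⟩ := hreg a
      exact ⟨a * x * a,
        ⟨a * x, subset_dcl _ ⟨a, ha, x, Set.mem_univ x, rfl⟩, a, ha, rfl⟩, hx⟩
  · intro h a
    obtain ⟨X, -, hX⟩ := h _ (isBiIdeal_principalBiIdeal hcomp a)
    have ha := mem_principalBiIdeal_self a
    rw [← hX] at ha
    obtain ⟨_, ⟨p, ⟨_, ⟨c, hc, s, -, rfl⟩, hp⟩, d, hd, rfl⟩, hle⟩ := ha
    obtain ⟨t, ht⟩ := exists_mul_mul_le_of_mem_principalBiIdeal hcomp hc hd s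
    exact ⟨t, (hle.trans (hcomp.mul_le_mul hp le_rfl)).trans ht⟩
end

section
/- An ordered semigroup S is regular if and only if for every right ideal R of S and every left ideal L of S one has (RL] = R ∩ L. -/
variable {S : Type*}

theorem self_mem_Rp [Semigroup S] [Preorder S] (a : S) : a ∈ Rp a :=
  subset_dcl _ (Or.inl rfl)

theorem self_mem_Lp [Semigroup S] [Preorder S] (a : S) : a ∈ Lp a :=
  subset_dcl _ (Or.inl rfl)

theorem isRightIdeal_Rp [Semigroup S] [Preorder S] (hcomp : OrdCompat S) (a : S) :
    IsRightIdeal (Rp a) := by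
  refine ⟨⟨a, self_mem_Rp a⟩, ?_, dcl_dcl _⟩
  rintro r ⟨b, rfl | ⟨t, rfl⟩, hr⟩ s
  · exact ⟨b * s, Or.inr ⟨s, rfl⟩, (hcomp s r b hr).2⟩
  · exact ⟨a * t * s, Or.inr ⟨t * s, (mul_assoc a t s).symm⟩, (hcomp s r (a * t) hr).2⟩

theorem isLeftIdeal_Lp [Semigroup S] [Preorder S] (hcomp : OrdCompat S) (a : S) :
    IsLeftIdeal (Lp a) := by
  refine ⟨⟨a, self_mem_Lp a⟩, ?_, dcl_dcl _⟩
  rintro l ⟨b, rfl | ⟨t, rfl⟩, hl⟩ s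
  · exact ⟨s * b, Or.inr ⟨s, rfl⟩, (hcomp s l b hl).1⟩
  · exact ⟨s * (t * a), Or.inr ⟨s * t, mul_assoc s t a⟩, (hcomp s l (t * a) hl).1⟩

theorem dcl_setMul_subset_inter [Semigroup S] [LE S] {R L : Set S}
    (hR : IsRightIdeal R) (hL : IsLeftIdeal L) : dcl (setMul R L) ⊆ R ∩ L := by
  rintro x ⟨_, ⟨r, hr, l, hl, rfl⟩, hx⟩
  exact ⟨hR.2.2 ▸ ⟨r * l, hR.2.1 r hr l, hx⟩, hL.2.2 ▸ ⟨r * l, hL.2.1 l hl r, hx⟩⟩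

theorem stmt_11 [Semigroup S] [PartialOrder S] (hcomp : OrdCompat S) :
    (∀ a : S, ∃ x : S, a ≤ a * x * a) ↔
      ∀ R L : Set S, IsRightIdeal R → IsLeftIdeal L → dcl (setMul R L) = R ∩ L := by
  constructor
  · intro hreg R L hR hL
    refine (dcl_setMul_subset_inter hR hL).antisymm ?_
    rintro a ⟨haR, haL⟩
    obtain ⟨x, hx⟩ := hreg a
    exact ⟨a * x * a, ⟨a * x, hR.2.1 a haR x, a, haL, rfl⟩, hx⟩
  · intro h a
    have ha : a ∈ dcl (setMul (Rp a) (Lp a)) := by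
      rw [h _ _ (isRightIdeal_Rp hcomp a) (isLeftIdeal_Lp hcomp a)]
      exact ⟨self_mem_Rp a, self_mem_Lp a⟩
    obtain ⟨_, ⟨u, ⟨u', hu', hu⟩, v, ⟨v', hv', hv⟩, rfl⟩, hauv⟩ := ha
    have key : a ≤ u' * v' :=
      hauv.trans ((hcomp v u u' hu).2.trans (hcomp u' v v' hv).1)
    rcases hu' with hu' | ⟨s, rfl⟩ <;> rcases hv' with hv' | ⟨t, rfl⟩
    · obtain rfl : u' = a := hu'
      obtain rfl : v' = u' := hv'
      exact ⟨v', key.trans (hcomp v' v' (v' * v') key).2⟩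
    · obtain rfl : u' = a := hu'
      exact ⟨t, by simpa only [mul_assoc] using key⟩
    · obtain rfl : v' = a := hv'
      exact ⟨s, key⟩
    · exact ⟨s * t, by simpa only [mul_assoc] using key⟩
end

section
/- Let S be a regular ordered semigroup. Then every bi-ideal B of S is of the form B = R ∩ L for some right ideal R of S and some left ideal L of S. -/
variable {S : Type*}

theorem isRightIdeal_dcl_setMul_univ [Semigroup S] [PartialOrder S] (hcomp : OrdCompat S)
    {B : Set S} (hB : B.Nonempty) : IsRightIdeal (dcl (setMul B Set.univ)) := by
  refine ⟨?_, ?_, dcl_dcl _⟩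
  · obtain ⟨b, hb⟩ := hB
    exact ⟨b * b, b * b, ⟨b, hb, b, trivial, rfl⟩, le_rfl⟩
  · rintro r ⟨_, ⟨b, hb, t, -, rfl⟩, hr⟩ s
    exact ⟨b * t * s, ⟨b, hb, t * s, trivial, mul_assoc b t s⟩, (hcomp s _ _ hr).2⟩

theorem isLeftIdeal_dcl_univ_setMul [Semigroup S] [PartialOrder S] (hcomp : OrdCompat S)
    {B : Set S} (hB : B.Nonempty) : IsLeftIdeal (dcl (setMul Set.univ B)) := by
  refine ⟨?_, ?_, dcl_dcl _⟩
  · obtain ⟨b, hb⟩ := hB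
    exact ⟨b * b, b * b, ⟨b, trivial, b, hb, rfl⟩, le_rfl⟩
  · rintro l ⟨_, ⟨t, -, b, hb, rfl⟩, hl⟩ s
    exact ⟨s * (t * b), ⟨s * t, trivial, b, hb, (mul_assoc s t b).symm⟩, (hcomp s _ _ hl).1⟩

theorem stmt_12 [Semigroup S] [PartialOrder S] (hcomp : OrdCompat S)
    (hreg : ∀ a : S, ∃ x : S, a ≤ a * x * a)
    (B : Set S) (hB : IsBiIdeal B) :
    ∃ R L : Set S, IsRightIdeal R ∧ IsLeftIdeal L ∧ B = R ∩ L := by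
  obtain ⟨hne, hmul, hdcl⟩ := hB
  refine ⟨_, _, isRightIdeal_dcl_setMul_univ hcomp hne, isLeftIdeal_dcl_univ_setMul hcomp hne, ?_⟩
  ext z
  obtain ⟨x, hx⟩ := hreg z
  constructor
  · intro hz
    exact ⟨⟨_, ⟨z, hz, x * z, trivial, mul_assoc z x z⟩, hx⟩,
      ⟨_, ⟨z * x, trivial, z, hz, rfl⟩, hx⟩⟩
  · rintro ⟨⟨_, ⟨b, hb, s, -, rfl⟩, hzb⟩, ⟨_, ⟨t, -, c, hc, rfl⟩, hzc⟩⟩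
    rw [← hdcl]
    refine ⟨b * (s * x * t) * c, hmul b hb _ c hc, ?_⟩
    calc z ≤ z * x * z := hx
      _ ≤ z * x * (t * c) := (hcomp _ _ _ hzc).1
      _ ≤ b * s * x * (t * c) := (hcomp _ _ _ ((hcomp x _ _ hzb).2)).2
      _ = b * (s * x * t) * c := by simp only [mul_assoc]
end

section
/- Let S be a regular ordered semigroup and a ∈ S. Then the principal bi-ideal generated by a equals the intersection of the principal right and left ideals generated by a: ({a} ∪ aSa] = ({a} ∪ aS] ∩ ({a} ∪ Sa]. -/
variable {S : Type*}

theorem stmt_13 [Semigroup S] [PartialOrder S] (hcomp : OrdCompat S)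
    (hreg : ∀ a : S, ∃ x : S, a ≤ a * x * a) (a : S) :
    dcl (({a} : Set S) ∪ Set.range (fun s : S => a * s * a)) =
      dcl (({a} : Set S) ∪ Set.range (fun s : S => a * s)) ∩
        dcl (({a} : Set S) ∪ Set.range (fun s : S => s * a)) := by
  ext x
  constructor
  · rintro ⟨_, rfl | ⟨s, rfl⟩, hx⟩
    · exact ⟨⟨_, Or.inl rfl, hx⟩, ⟨_, Or.inl rfl, hx⟩⟩
    · exact ⟨⟨_, Or.inr ⟨s * a, (mul_assoc a s a).symm⟩, hx⟩, ⟨_, Or.inr ⟨a * s, rfl⟩, hx⟩⟩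
  · rintro ⟨⟨_, rfl | ⟨s, rfl⟩, hr⟩, ⟨_, rfl | ⟨t, rfl⟩, hl⟩⟩
    · exact ⟨_, Or.inl rfl, hr⟩
    · exact ⟨_, Or.inl rfl, hr⟩
    · exact ⟨_, Or.inl rfl, hl⟩
    · obtain ⟨y, hy⟩ := hreg x
      refine ⟨a * (s * y * t) * a, Or.inr ⟨s * y * t, rfl⟩, ?_⟩
      calc x ≤ x * y * x := hy
        _ ≤ a * s * y * x := (hcomp x _ _ (hcomp y _ _ hr).2).2
        _ ≤ a * s * y * (t * a) := (hcomp _ _ _ hl).1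
        _ = a * (s * y * t) * a := by simp only [mul_assoc]
end

section
/- Let X be a nonempty finite set and T_X the full transformation semigroup on X with multiplication (f∗g)(x) = g(f(x)), ordered by the natural partial order: f ≤ g iff f∗T_X ⊆ g∗T_X and there exists α ∈ T_X with f = α∗f and f = α∗g. Then for f, g ∈ T_X, the principal left ideals in (T_X, ≤) coincide, i.e. ({f} ∪ T_X∗f] = ({g} ∪ T_X∗g], if and only if f and g are Green's 𝓛-related in the plain semigroup T_X, i.e. the ranges of f and g are equal: f(X) = g(X). -/
variable {X : Type*}

/-- Multiplication of the full transformation semigroup: `(f∗g)(x) = g (f x)`. -/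
def tmul (f g : X → X) : X → X := fun x => g (f x)

/-- The natural partial order on the full transformation semigroup:
`f ≤ g` iff `f∗T_X ⊆ g∗T_X` and there is `α` with `f = α∗f = α∗g`. -/
def tle (f g : X → X) : Prop :=
  Set.range (tmul f) ⊆ Set.range (tmul g) ∧ ∃ α : X → X, f = tmul α f ∧ f = tmul α g

/-- Downward closure with respect to the natural partial order. -/
def tdcl (A : Set (X → X)) : Set (X → X) := {t | ∃ a ∈ A, tle t a}

theorem tle_refl {X : Type*} (f : X → X) : tle f f :=
  ⟨subset_rfl, id, rfl, rfl⟩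

theorem range_tmul_subset {X : Type*} (s f : X → X) : Set.range (tmul s f) ⊆ Set.range f := by
  rintro _ ⟨x, rfl⟩
  exact ⟨s x, rfl⟩

theorem range_subset_of_tle {X : Type*} {f g : X → X} (h : tle f g) :
    Set.range f ⊆ Set.range g := by
  obtain ⟨-, α, -, hα⟩ := h
  rw [hα]
  exact range_tmul_subset α g

/-- The principal left ideal generated by `f` consists of the maps with range inside that of `f`. -/
theorem mem_tdcl_principal_iff {X : Type*} (f t : X → X) :
    t ∈ tdcl (({f} : Set (X → X)) ∪ Set.range (fun s : X → X => tmul s f)) ↔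
      Set.range t ⊆ Set.range f := by
  constructor
  · rintro ⟨a, rfl | ⟨s, rfl⟩, h⟩
    · exact range_subset_of_tle h
    · exact (range_subset_of_tle h).trans (range_tmul_subset s f)
  · intro h
    choose s hs using fun x => h ⟨x, rfl⟩
    exact ⟨t, Or.inr ⟨s, funext hs⟩, tle_refl t⟩

theorem stmt_16 (X : Type*) [Finite X] [Nonempty X] (f g : X → X) :
    tdcl (({f} : Set (X → X)) ∪ Set.range (fun s : X → X => tmul s f)) =
        tdcl (({g} : Set (X → X)) ∪ Set.range (fun s : X → X => tmul s g)) ↔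
      Set.range f = Set.range g := by
  simp only [Set.ext_iff (a := tdcl _), mem_tdcl_principal_iff]
  exact ⟨fun h => ((h f).1 subset_rfl).antisymm ((h g).2 subset_rfl), fun h t => by rw [h]⟩
end

section
/- Let S be an ordered semigroup and let A and B be bi-ideals of S. Then (AB] is again a bi-ideal of S (so the collection of bi-ideals is closed under the product A∗B = (AB]). -/
variable {S : Type*}

theorem stmt_19 [Semigroup S] [PartialOrder S] (hcomp : OrdCompat S)
    (A B : Set S) (hA : IsBiIdeal A) (hB : IsBiIdeal B) :
    IsBiIdeal (dcl (setMul A B)) := by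
  obtain ⟨⟨a₀, ha₀⟩, hA, -⟩ := hA
  obtain ⟨b₀, hb₀⟩ := hB.1
  refine ⟨⟨a₀ * b₀, a₀ * b₀, ⟨a₀, ha₀, b₀, hb₀, rfl⟩, le_rfl⟩, ?_, ?_⟩
  · rintro x ⟨_, ⟨a, ha, b, -, rfl⟩, hx⟩ s y ⟨_, ⟨c, hc, d, hd, rfl⟩, hy⟩
    refine ⟨a * b * s * (c * d), ⟨a * (b * s) * c, hA a ha _ c hc, d, hd, ?_⟩, ?_⟩
    · simp only [mul_assoc]
    · exact ((hcomp _ _ _ hy).1).trans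
        (hcomp _ _ _ (hcomp s _ _ hx).2).2
  · refine Set.Subset.antisymm ?_ fun x hx => ⟨x, hx, le_rfl⟩
    rintro x ⟨y, ⟨z, hz, hyz⟩, hxy⟩
    exact ⟨z, hz, hxy.trans hyz⟩
end
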